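/- arXiv:2603.02827 — 2 statements merged into one kernel-verified Lean document; each statement's English description precedes it below -/
import Mathlib

section
/- Let G be a biconnected series-parallel simple graph with no transitive edges, let (s,t) be a separation pair of G, and let G' be a light component of G with respect to (s,t) having at least two internal vertices. Then it is not the case that both at least two internal vertices of G' are adjacent to s and at least two internal vertices of G' are adjacent to t. -/
open SimpleGraph

variable {V : Type*}

/-- A simple graph is biconnected if it has at least three vertices, is connected,
and deleting any single vertex leaves it connected. -/
def Biconnected [Fintype V] (G : SimpleGraph V) : Prop :=
  3 ≤ Fintype.card V ∧ G.Connected ∧ ∀ x : V, (G.induce {v | v ≠ x}).Connected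

/-- `C` is the vertex set of a connected component of the subgraph of `G` induced by `D`:
`C` is a nonempty subset of `D`, induces a connected graph, and is closed under
adjacency within `D`. -/
def IsCCOf (G : SimpleGraph V) (D C : Set V) : Prop :=
  C.Nonempty ∧ C ⊆ D ∧ (G.induce C).Connected ∧
    ∀ u ∈ C, ∀ w ∈ D, G.Adj u w → w ∈ C

/-- `(s, t)` is a separation pair: `s ≠ t` and `G - s - t` is disconnected. -/
def SepPair (G : SimpleGraph V) (s t : V) : Prop :=
  s ≠ t ∧ ¬ (G.induce {v | v ≠ s ∧ v ≠ t}).Preconnected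

/-- `C` is the set of internal vertices of a component of `G` w.r.t. the separation
pair `(s, t)`, i.e. the vertex set of a connected component of `G - s - t`.
(The component itself is the subgraph induced by `C ∪ {s, t}`.) -/
def IsCompAt (G : SimpleGraph V) (s t : V) (C : Set V) : Prop :=
  IsCCOf G {v | v ≠ s ∧ v ≠ t} C

/-- The component with internal vertices `C` and poles `s, t` is heavy if some internal
vertex is adjacent to neither `s` nor `t`. -/
def Heavy (G : SimpleGraph V) (s t : V) (C : Set V) : Prop :=
  ∃ v ∈ C, ¬ G.Adj v s ∧ ¬ G.Adj v t

/-- The component with internal vertices `C` and poles `s, t` is light if every internal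
vertex is adjacent to `s` or to `t`. -/
def Light (G : SimpleGraph V) (s t : V) (C : Set V) : Prop :=
  ∀ v ∈ C, G.Adj v s ∨ G.Adj v t

/-- `G` has no transitive edges: no edge joins the two vertices of a separation pair. -/
def NoTransitiveEdges (G : SimpleGraph V) : Prop :=
  ∀ s t : V, SepPair G s t → ¬ G.Adj s t

/-- The internal vertices of a walk: its support minus the two endpoints. -/
def interiorSet {G : SimpleGraph V} {u v : V} (w : G.Walk u v) : Set V :=
  {x | x ∈ w.support ∧ x ≠ u ∧ x ≠ v}

/-- `G` contains a subdivision of `K₄`: four distinct vertices joined pairwise by six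
paths that are pairwise internally disjoint and whose internal vertices avoid the four
branch vertices. -/
def ContainsK4Subdivision (G : SimpleGraph V) : Prop :=
  ∃ (a b c d : V) (pab : G.Walk a b) (pac : G.Walk a c) (pad : G.Walk a d)
    (pbc : G.Walk b c) (pbd : G.Walk b d) (pcd : G.Walk c d),
    ([a, b, c, d] : List V).Nodup ∧
    pab.IsPath ∧ pac.IsPath ∧ pad.IsPath ∧
    pbc.IsPath ∧ pbd.IsPath ∧ pcd.IsPath ∧
    ([interiorSet pab, interiorSet pac, interiorSet pad,
      interiorSet pbc, interiorSet pbd, interiorSet pcd]).Pairwise Disjoint ∧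
    ∀ I ∈ [interiorSet pab, interiorSet pac, interiorSet pad,
      interiorSet pbc, interiorSet pbd, interiorSet pcd],
      ∀ x ∈ I, x ∉ ({a, b, c, d} : Set V)

/-- Walk-style connectivity of a vertex set. -/
def ConnSet (G : SimpleGraph V) (B : Set V) : Prop :=
  ∀ x ∈ B, ∀ y ∈ B, ∃ w : G.Walk x y, ∀ v ∈ w.support, v ∈ B

lemma connSet_of_induce {G : SimpleGraph V} {B : Set V} (h : (G.induce B).Preconnected) :
    ConnSet G B := by
  intro x hx y hy
  obtain ⟨w⟩ := h ⟨x, hx⟩ ⟨y, hy⟩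
  refine ⟨w.map (SimpleGraph.Embedding.induce B).toHom, ?_⟩
  intro v hv
  have hv := (SimpleGraph.Walk.support_map (SimpleGraph.Embedding.induce B).toHom w) ▸ hv
  obtain ⟨a, _, rfl⟩ := List.mem_map.1 hv
  exact a.2

lemma connSet_singleton (G : SimpleGraph V) (a : V) : ConnSet G {a} := by
  rintro x rfl y rfl
  exact ⟨SimpleGraph.Walk.nil, by simp⟩

lemma connSet_union {G : SimpleGraph V} {A B : Set V} (hA : ConnSet G A) (hB : ConnSet G B)
    {a b : V} (ha : a ∈ A) (hb : b ∈ B) (hab : G.Adj a b) : ConnSet G (A ∪ B) := by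
  have key : ∀ x ∈ A, ∀ y ∈ B, ∃ w : G.Walk x y, ∀ v ∈ w.support, v ∈ A ∪ B := by
    intro x hx y hy
    obtain ⟨w1, h1⟩ := hA x hx a ha
    obtain ⟨w2, h2⟩ := hB b hb y hy
    refine ⟨w1.append (SimpleGraph.Walk.cons hab w2), ?_⟩
    intro v hv
    rw [SimpleGraph.Walk.mem_support_append_iff] at hv
    rcases hv with hv | hv
    · exact Or.inl (h1 v hv)
    · rw [SimpleGraph.Walk.support_cons, List.mem_cons] at hv
      rcases hv with rfl | hv
      · exact Or.inl ha
      · exact Or.inr (h2 v hv)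
  rintro x (hx | hx) y (hy | hy)
  · obtain ⟨w, h⟩ := hA x hx y hy
    exact ⟨w, fun v hv => Or.inl (h v hv)⟩
  · exact key x hx y hy
  · obtain ⟨w, h⟩ := key y hy x hx
    exact ⟨w.reverse, fun v hv => h v (by simpa using hv)⟩
  · obtain ⟨w, h⟩ := hB x hx y hy
    exact ⟨w, fun v hv => Or.inr (h v hv)⟩

lemma connSet_pair {G : SimpleGraph V} {a b : V} (h : G.Adj a b) : ConnSet G {a, b} := by
  have := connSet_union (connSet_singleton G a) (connSet_singleton G b) rfl rfl h
  rwa [Set.singleton_union] at this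

lemma exists_comp (G : SimpleGraph V) (X : Set V) (d : V) (hd : d ∈ X) :
    ∃ D : Set V, d ∈ D ∧ D ⊆ X ∧ ConnSet G D ∧ ∀ u ∈ D, ∀ w ∈ X, G.Adj u w → w ∈ D := by
  classical
  refine ⟨{v | ∃ w : G.Walk d v, ∀ x ∈ w.support, x ∈ X}, ?_, ?_, ?_, ?_⟩
  · exact ⟨SimpleGraph.Walk.nil, by simpa using hd⟩
  · rintro v ⟨w, hw⟩
    exact hw v w.end_mem_support
  · rintro x ⟨w1, h1⟩ y ⟨w2, h2⟩
    refine ⟨w1.reverse.append w2, ?_⟩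
    intro v hv
    rw [SimpleGraph.Walk.mem_support_append_iff] at hv
    rcases hv with hv | hv
    · have hv : v ∈ w1.support := by simpa using hv
      exact ⟨w1.takeUntil v hv, fun x hx => h1 x (w1.support_takeUntil_subset_support hv hx)⟩
    · exact ⟨w2.takeUntil v hv, fun x hx => h2 x (w2.support_takeUntil_subset_support hv hx)⟩
  · rintro u ⟨w, hw⟩ v hv huv
    refine ⟨w.concat huv, ?_⟩
    intro x hx
    rw [SimpleGraph.Walk.support_concat] at hx
    rcases (by simpa using hx : x ∈ w.support ∨ x = v) with hx | rfl
    · exact hw x hx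
    · exact hv

lemma walk_leaves {G : SimpleGraph V} {D X : Set V} {u w : V} (p : G.Walk u w)
    (hp : ∀ v ∈ p.support, v ∈ X) (hu : u ∈ D) (hw : w ∉ D) :
    ∃ a ∈ D, ∃ b ∈ X, b ∉ D ∧ G.Adj a b := by
  induction p with
  | nil => exact absurd hu hw
  | @cons u v w h p ih =>
    by_cases hv : v ∈ D
    · exact ih (fun x hx => hp x (by simp [hx])) hv hw
    · exact ⟨u, hu, v, hp v (by simp), hv, h⟩

lemma exists_leaving {G : SimpleGraph V} {D X : Set V} (hX : ConnSet G X) {u w : V}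
    (hu : u ∈ D) (huX : u ∈ X) (hw : w ∉ D) (hwX : w ∈ X) :
    ∃ a ∈ D, ∃ b ∈ X, b ∉ D ∧ G.Adj a b := by
  obtain ⟨p, hp⟩ := hX u huX w hwX
  exact walk_leaves p hp hu hw

lemma walk_first_hit {G : SimpleGraph V} {P : Set V} {z x : V} (w : G.Walk z x) (hx : x ∈ P) :
    ∃ c ∈ P, ∃ q : G.Walk z c, (∀ v ∈ q.support, v ∈ w.support) ∧
      ∀ v ∈ q.support, v ∈ P → v = c := by
  induction w with
  | nil => exact ⟨_, hx, SimpleGraph.Walk.nil, by simp, by simp⟩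
  | @cons z y x h w ih =>
    by_cases hz : z ∈ P
    · exact ⟨z, hz, SimpleGraph.Walk.nil, by simp, by simp⟩
    · obtain ⟨c, hc, q, h1, h2⟩ := ih hx
      refine ⟨c, hc, SimpleGraph.Walk.cons h q, ?_, ?_⟩
      · intro v hv
        simp only [SimpleGraph.Walk.support_cons, List.mem_cons] at hv ⊢
        rcases hv with hv | hv
        · exact Or.inl hv
        · exact Or.inr (h1 v hv)
      · intro v hv hvP
        simp only [SimpleGraph.Walk.support_cons, List.mem_cons] at hv
        rcases hv with rfl | hv
        · exact absurd hvP hz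
        · exact h2 v hv hvP

/-- `A` carries a walk from `c` to `x`. -/
def Arm (G : SimpleGraph V) (A : Set V) (c x : V) : Prop :=
  ∃ w : G.Walk c x, ∀ v ∈ w.support, v ∈ A

lemma tripod {G : SimpleGraph V} {B : Set V} (hB : ConnSet G B) {x y z : V}
    (hx : x ∈ B) (hy : y ∈ B) (hz : z ∈ B) :
    ∃ c ∈ B, ∃ X Y Z : Set V, Arm G X c x ∧ Arm G Y c y ∧ Arm G Z c z ∧
      X ⊆ B ∧ Y ⊆ B ∧ Z ⊆ B ∧ (∀ v ∈ X, v ∈ Y → v = c) ∧ (∀ v ∈ X, v ∈ Z → v = c) ∧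
      (∀ v ∈ Y, v ∈ Z → v = c) := by
  classical
  obtain ⟨w, hw⟩ := hB x hx y hy
  have hb : ∀ v ∈ w.bypass.support, v ∈ B := fun v hv => hw v (w.support_bypass_subset_support hv)
  have hp : w.bypass.IsPath := w.bypass_isPath
  generalize w.bypass = p at hb hp
  obtain ⟨w2, hw2⟩ := hB z hz x hx
  obtain ⟨c, hc, q, hq1, hq2⟩ := walk_first_hit (P := {v | v ∈ p.support}) w2
    (by simp)
  have hc : c ∈ p.support := hc
  refine ⟨c, hb c hc, {v | v ∈ (p.takeUntil c hc).support}, {v | v ∈ (p.dropUntil c hc).support},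
    {v | v ∈ q.support}, ⟨(p.takeUntil c hc).reverse, by simp⟩, ⟨p.dropUntil c hc, by simp⟩,
    ⟨q.reverse, by simp⟩, ?_, ?_, ?_, ?_, ?_, ?_⟩
  · exact fun v hv => hb v (p.support_takeUntil_subset_support hc hv)
  · exact fun v hv => hb v (p.support_dropUntil_subset_support hc hv)
  · exact fun v hv => hw2 v (hq1 v hv)
  · intro v h1 h2
    by_contra hne
    have hp' := hp
    rw [← p.take_spec hc, SimpleGraph.Walk.isPath_def, SimpleGraph.Walk.support_append,
      List.nodup_append] at hp'
    have h3 : v ∈ (p.dropUntil c hc).support.tail := by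
      have h2 : v ∈ (p.dropUntil c hc).support := h2
      rw [← SimpleGraph.Walk.cons_tail_support, List.mem_cons] at h2
      exact h2.resolve_left hne
    exact hp'.2.2 v h1 v h3 rfl
  · exact fun v h1 h2 => hq2 v h2 (p.support_takeUntil_subset_support hc h1)
  · exact fun v h1 h2 => hq2 v h2 (p.support_dropUntil_subset_support hc h1)

lemma link {G : SimpleGraph V} {A B : Set V} {c d x y : V} (hA : Arm G A c x) (hB : Arm G B d y)
    (h : G.Adj x y) : ∃ p : G.Walk c d, p.IsPath ∧ ∀ v ∈ p.support, v ∈ A ∨ v ∈ B := by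
  classical
  obtain ⟨w1, h1⟩ := hA
  obtain ⟨w2, h2⟩ := hB
  refine ⟨(w1.append (SimpleGraph.Walk.cons h w2.reverse)).bypass,
    SimpleGraph.Walk.bypass_isPath _, ?_⟩
  intro v hv
  have hv := SimpleGraph.Walk.support_bypass_subset_support _ hv
  rw [SimpleGraph.Walk.mem_support_append_iff] at hv
  rcases hv with hv | hv
  · exact Or.inl (h1 v hv)
  · rw [SimpleGraph.Walk.support_cons, List.mem_cons] at hv
    rcases hv with rfl | hv
    · exact Or.inl (h1 _ w1.end_mem_support)
    · exact Or.inr (h2 v (by simpa using hv))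

/-- Two vertex sets joined by an edge. -/
def Touch (G : SimpleGraph V) (A B : Set V) : Prop := ∃ a ∈ A, ∃ b ∈ B, G.Adj a b

lemma k4_of_model {G : SimpleGraph V} {A B C D : Set V}
    (hA : ConnSet G A) (hB : ConnSet G B) (hC : ConnSet G C) (hD : ConnSet G D)
    (dAB : ∀ v ∈ A, v ∉ B) (dAC : ∀ v ∈ A, v ∉ C) (dAD : ∀ v ∈ A, v ∉ D)
    (dBC : ∀ v ∈ B, v ∉ C) (dBD : ∀ v ∈ B, v ∉ D) (dCD : ∀ v ∈ C, v ∉ D)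
    (tAB : Touch G A B) (tAC : Touch G A C) (tAD : Touch G A D)
    (tBC : Touch G B C) (tBD : Touch G B D) (tCD : Touch G C D) :
    ContainsK4Subdivision G := by
  obtain ⟨ab, hab, ba, hba, eab⟩ := tAB
  obtain ⟨ac, hac, ca, hca, eac⟩ := tAC
  obtain ⟨ad, had, da, hda, ead⟩ := tAD
  obtain ⟨bc, hbc, cb, hcb, ebc⟩ := tBC
  obtain ⟨bd, hbd, db, hdb, ebd⟩ := tBD
  obtain ⟨cd, hcd, dc, hdc, ecd⟩ := tCD
  obtain ⟨a, ha, AB, AC, AD, wAB, wAC, wAD, sAB, sAC, sAD, iA1, iA2, iA3⟩ := tripod hA hab hac had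
  obtain ⟨b, hb, BA, BC, BD, wBA, wBC, wBD, sBA, sBC, sBD, iB1, iB2, iB3⟩ := tripod hB hba hbc hbd
  obtain ⟨c, hc, CA, CB, CD, wCA, wCB, wCD, sCA, sCB, sCD, iC1, iC2, iC3⟩ := tripod hC hca hcb hcd
  obtain ⟨d, hd, DA, DB, DC, wDA, wDB, wDC, sDA, sDB, sDC, iD1, iD2, iD3⟩ := tripod hD hda hdb hdc
  obtain ⟨pab, qab, rab⟩ := link wAB wBA eab
  obtain ⟨pac, qac, rac⟩ := link wAC wCA eac
  obtain ⟨pad, qad, rad⟩ := link wAD wDA ead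
  obtain ⟨pbc, qbc, rbc⟩ := link wBC wCB ebc
  obtain ⟨pbd, qbd, rbd⟩ := link wBD wDB ebd
  obtain ⟨pcd, qcd, rcd⟩ := link wCD wDC ecd
  clear wAB wAC wAD wBA wBC wBD wCA wCB wCD wDA wDB wDC
  clear hab hba eab hac hca eac had hda ead hbc hcb ebc hbd hdb ebd hcd hdc ecd hA hB hC hD
  simp only [Set.subset_def] at *
  have key : ∀ {x y : V} (p : G.Walk x y) (S T : Set V), (∀ v ∈ p.support, v ∈ S ∨ v ∈ T) →
      ∀ v ∈ interiorSet p, (v ∈ S ∨ v ∈ T) ∧ v ≠ x ∧ v ≠ y :=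
    fun p S T h v hv => ⟨h v hv.1, hv.2⟩
  have kab := key pab _ _ rab
  have kac := key pac _ _ rac
  have kad := key pad _ _ rad
  have kbc := key pbc _ _ rbc
  have kbd := key pbd _ _ rbd
  have kcd := key pcd _ _ rcd
  clear key
  refine ⟨a, b, c, d, pab, pac, pad, pbc, pbd, pcd, ?_, qab, qac, qad, qbc, qbd, qcd, ?_, ?_⟩
  · clear rab rac rad rbc rbd rcd kab kac kad kbc kbd kcd
    simp only [List.nodup_cons, List.mem_cons, List.not_mem_nil, not_or]
    refine ⟨⟨?_, ?_, ?_, ?_⟩, ⟨?_, ?_, ?_⟩, ⟨?_, ?_⟩, ?_, List.nodup_nil⟩ <;> grind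
  · clear rab rac rad rbc rbd rcd qab qac qad qbc qbd qcd
    generalize interiorSet pab = Iab at *
    generalize interiorSet pac = Iac at *
    generalize interiorSet pad = Iad at *
    generalize interiorSet pbc = Ibc at *
    generalize interiorSet pbd = Ibd at *
    generalize interiorSet pcd = Icd at *
    simp only [List.pairwise_cons, List.mem_cons, List.not_mem_nil, or_false, forall_eq_or_imp,
      forall_eq, Set.disjoint_left]
    refine ⟨⟨?_, ?_, ?_, ?_, ?_⟩, ⟨?_, ?_, ?_, ?_⟩, ⟨?_, ?_, ?_⟩, ⟨?_, ?_⟩, ?_, ?_⟩ <;>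
      first
      | (intro v h1 h2
         first
         | (replace h1 := kab v h1) | (replace h1 := kac v h1) | (replace h1 := kad v h1)
         | (replace h1 := kbc v h1) | (replace h1 := kbd v h1) | (replace h1 := kcd v h1)
         first
         | (replace h2 := kab v h2) | (replace h2 := kac v h2) | (replace h2 := kad v h2)
         | (replace h2 := kbc v h2) | (replace h2 := kbd v h2) | (replace h2 := kcd v h2)
         clear kab kac kad kbc kbd kcd
         obtain ⟨h1 | h1, h3, h4⟩ := h1 <;> obtain ⟨h2 | h2, h5, h6⟩ := h2 <;> grind)
      | simp
  · clear rab rac rad rbc rbd rcd qab qac qad qbc qbd qcd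
    generalize interiorSet pab = Iab at *
    generalize interiorSet pac = Iac at *
    generalize interiorSet pad = Iad at *
    generalize interiorSet pbc = Ibc at *
    generalize interiorSet pbd = Ibd at *
    generalize interiorSet pcd = Icd at *
    simp only [List.mem_cons, List.not_mem_nil, or_false, forall_eq_or_imp, forall_eq,
      Set.mem_insert_iff, Set.mem_singleton_iff, not_or]
    refine ⟨?_, ?_, ?_, ?_, ?_, ?_⟩ <;>
      (intro v h1
       first
         | (replace h1 := kab v h1) | (replace h1 := kac v h1) | (replace h1 := kad v h1)
         | (replace h1 := kbc v h1) | (replace h1 := kbd v h1) | (replace h1 := kcd v h1)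
       clear kab kac kad kbc kbd kcd
       obtain ⟨h1 | h1, h3, h4⟩ := h1 <;> refine ⟨?_, ?_, ?_, ?_⟩ <;> rintro rfl <;> grind)

/-- A distance function on a connected set. -/
lemma exists_dist (G : SimpleGraph V) (C : Set V) (hC : (G.induce C).Connected) (x : V)
    (hx : x ∈ C) : ∃ f : V → ℕ, f x = 0 ∧
      (∀ v ∈ C, v ≠ x → ∃ u ∈ C, G.Adj v u ∧ f v = f u + 1) ∧
      (∀ v ∈ C, ∀ u ∈ C, G.Adj u v → f v ≤ f u + 1) := by
  classical
  set H := G.induce C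
  refine ⟨fun v => if h : v ∈ C then H.dist ⟨x, hx⟩ ⟨v, h⟩ else 0, by simp [hx], ?_, ?_⟩
  · intro v hv hne
    obtain ⟨w, hw⟩ := hC.exists_walk_length_eq_dist ⟨v, hv⟩ ⟨x, hx⟩
    cases w with
    | nil => exact absurd rfl hne
    | @cons _ u _ h w =>
      refine ⟨u.1, u.2, h, ?_⟩
      simp only [hv, u.2, dif_pos]
      rw [SimpleGraph.dist_comm, H.dist_comm (u := ⟨x, hx⟩)]
      have h1 : H.dist u ⟨x, hx⟩ ≤ w.length := SimpleGraph.dist_le w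
      rw [SimpleGraph.Walk.length_cons] at hw
      have h2 : H.dist ⟨v, hv⟩ ⟨x, hx⟩ ≤ H.dist ⟨v, hv⟩ u + H.dist u ⟨x, hx⟩ := hC.dist_triangle
      have h3 : H.dist ⟨v, hv⟩ u = 1 := SimpleGraph.dist_eq_one_iff_adj.2 h
      change _ = H.dist u _ + 1
      omega
  · intro v hv u hu huv
    simp only [hv, hu, dif_pos]
    have h2 : H.dist ⟨x, hx⟩ ⟨v, hv⟩ ≤ H.dist ⟨x, hx⟩ ⟨u, hu⟩ + H.dist ⟨u, hu⟩ ⟨v, hv⟩ :=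
      hC.dist_triangle
    have h3 : H.dist ⟨u, hu⟩ ⟨v, hv⟩ = 1 := SimpleGraph.dist_eq_one_iff_adj.2 huv
    omega

lemma far_noncut {G : SimpleGraph V} {C : Set V} {x r : V} {f : V → ℕ}
    (hx : x ∈ C) (hrx : r ≠ x)
    (hf : ∀ v ∈ C, v ≠ x → ∃ u ∈ C, G.Adj v u ∧ f v = f u + 1)
    (hmax : ∀ v ∈ C, f v ≤ f r) : ConnSet G (C \ {r}) := by
  have key : ∀ n, ∀ v ∈ C \ {r}, f v = n → ∃ w : G.Walk v x, ∀ y ∈ w.support, y ∈ C \ {r} := by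
    intro n
    induction n using Nat.strong_induction_on with
    | _ n ih =>
      intro v hv hn
      by_cases hvx : v = x
      · subst hvx
        exact ⟨SimpleGraph.Walk.nil, by simpa using hv⟩
      · obtain ⟨u, hu, huv, hfu⟩ := hf v hv.1 hvx
        have hur : u ≠ r := by
          rintro rfl
          have := hmax v hv.1
          omega
        obtain ⟨w, hw⟩ := ih (f u) (by omega) u ⟨hu, hur⟩ rfl
        refine ⟨SimpleGraph.Walk.cons huv w, ?_⟩
        intro y hy
        rw [SimpleGraph.Walk.support_cons, List.mem_cons] at hy
        rcases hy with rfl | hy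
        · exact hv
        · exact hw y hy
  intro a ha b hb
  obtain ⟨w1, h1⟩ := key _ a ha rfl
  obtain ⟨w2, h2⟩ := key _ b hb rfl
  refine ⟨w1.append w2.reverse, ?_⟩
  intro v hv
  rw [SimpleGraph.Walk.mem_support_append_iff] at hv
  rcases hv with hv | hv
  · exact h1 v hv
  · exact h2 v (by simpa using hv)

/-- The tail of the argument once a first leaf `l` adjacent to `s` has been found. -/
lemma finish [Finite V] {G : SimpleGraph V} {s t : V} {C : Set V} (hC : (G.induce C).Connected)
    (hK : ∀ A B : Set V, A ⊆ C → B ⊆ C → (∀ v ∈ A, v ∉ B) → ConnSet G A → ConnSet G B →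
      Touch G A B → (∃ v ∈ A, G.Adj v s) → (∃ v ∈ A, G.Adj v t) → (∃ v ∈ B, G.Adj v s) →
      (∃ v ∈ B, G.Adj v t) → False)
    (hleaf : ∀ l ∈ C, ConnSet G (C \ {l}) → ∃ p ∈ C, G.Adj l p ∧ (∀ q ∈ C, G.Adj l q → q = p) ∧
      ((G.Adj l s ∧ ¬ G.Adj l t ∧ G.Adj p t ∧ ¬ G.Adj p s) ∨
       (G.Adj l t ∧ ¬ G.Adj l s ∧ G.Adj p s ∧ ¬ G.Adj p t)))
    (ht : ∀ p, ∃ q ∈ C, G.Adj q t ∧ q ≠ p)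
    {l p : V} (hl : l ∈ C) (hp : p ∈ C) (hlp : G.Adj l p) (hu : ∀ q ∈ C, G.Adj l q → q = p)
    (hls : G.Adj l s) (hlt : ¬ G.Adj l t) (hpt : G.Adj p t) : False := by
  obtain ⟨f, hf0, hf1, hf2⟩ := exists_dist G C hC l hl
  obtain ⟨q, hq, hqt, hqp⟩ := ht p
  have hql : q ≠ l := by rintro rfl; exact hlt hqt
  have hfp : f p ≤ 1 := by have := hf2 p hp l hl hlp; omega
  obtain ⟨r, hr, hmax⟩ := Set.exists_max_image C f (Set.toFinite C) ⟨l, hl⟩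
  -- analysis of `q`
  obtain ⟨u, huC, hqu, hfq⟩ := hf1 q hq hql
  have hul : u ≠ l := by rintro rfl; exact hqp (hu q hq hqu.symm)
  obtain ⟨u', huC', huu, hfu⟩ := hf1 u huC hul
  by_cases hr2 : f r ≤ 2
  · have hqr : f q = f r := by
      have := hmax q hq
      omega
    have hnc := far_noncut hl hql hf1 (fun v hv => hqr ▸ hmax v hv)
    obtain ⟨p', hp', hqp', hun, h⟩ := hleaf q hq hnc
    have hu'l : u' = l := by
      by_contra hne
      obtain ⟨x, _, _, hx⟩ := hf1 u' huC' hne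
      have := hmax q hq
      omega
    subst hu'l
    have hup : u = p := hu u huC huu.symm
    have : u = p' := hun u huC hqu
    subst hup
    subst this
    rcases h with h | h
    · exact h.2.1 hqt
    · exact h.2.2.2 hpt
  · have hrl : r ≠ l := by rintro rfl; omega
    have hnc := far_noncut hl hrl hf1 hmax
    obtain ⟨p', hp', hrp', hun, h⟩ := hleaf r hr hnc
    obtain ⟨y, hy, hry, hfy⟩ := hf1 r hr hrl
    have : y = p' := hun y hy hry
    subst this
    have hrp : r ≠ p := by rintro rfl; omega
    have hyp : y ≠ p := by rintro rfl; omega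
    have hyl : y ≠ l := by rintro rfl; omega
    obtain ⟨B, hrB, hBX, hBc, hBcl⟩ := exists_comp G (C \ {l, p}) r ⟨hr, by simp [hrl, hrp]⟩
    have hyB : y ∈ B := hBcl r hrB y ⟨hy, by simp [hyl, hyp]⟩ hry
    obtain ⟨a, ha, b, hb, hbB, hab⟩ := exists_leaving (connSet_of_induce hC.preconnected)
      hrB hr (fun h : l ∈ B => (hBX h).2 (by simp)) hl
    have hbA : b ∈ ({l, p} : Set V) := by
      by_contra hne
      exact hbB (hBcl a ha b ⟨hb, hne⟩ hab)
    refine hK {l, p} B ?_ (fun v hv => (hBX hv).1) (fun v hv hvB => (hBX hvB).2 hv)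
      (connSet_pair hlp) hBc ⟨b, hbA, a, ha, hab.symm⟩ ⟨l, by simp, hls⟩ ⟨p, by simp, hpt⟩ ?_ ?_
    · rintro v (rfl | rfl) <;> assumption
    · rcases h with h | h
      · exact ⟨r, hrB, h.1⟩
      · exact ⟨y, hyB, h.2.2.1⟩
    · rcases h with h | h
      · exact ⟨y, hyB, h.2.2.1⟩
      · exact ⟨r, hrB, h.1⟩

/-- A leaf adjacent to `s` has a neighbour that is not adjacent to `s`. -/
lemma no_trans {G : SimpleGraph V} (hTr : NoTransitiveEdges G) {s t : V} (hst : s ≠ t) {C : Set V}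
    (hCD : C ⊆ {v | v ≠ s ∧ v ≠ t})
    (hCcl : ∀ u ∈ C, ∀ w ∈ {v | v ≠ s ∧ v ≠ t}, G.Adj u w → w ∈ C) {l p : V} (hl : l ∈ C)
    (hp : p ∈ C) (hlp : G.Adj l p) (hu : ∀ q ∈ C, G.Adj l q → q = p) (hlt : ¬ G.Adj l t) :
    ¬ G.Adj p s := by
  apply hTr
  refine ⟨(hCD hp).1, fun h => ?_⟩
  have hc := connSet_of_induce h
  obtain ⟨a, ha, b, hb, hbl, hab⟩ := exists_leaving (D := {l}) (u := l) (w := t) hc rfl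
    ⟨hlp.ne, (hCD hl).1⟩ (fun h => (hCD hl).2 h.symm) ⟨(hCD hp).2.symm, hst.symm⟩
  obtain rfl : a = l := ha
  by_cases hbt : b = t
  · exact hlt (hbt ▸ hab)
  · exact hb.1 (hu b (hCcl a hl b ⟨hb.2, hbt⟩ hab) hab)

/-- In a biconnected series-parallel simple graph without transitive edges, a light
component w.r.t. a separation pair `(s, t)` with at least two internal vertices cannot
have both at least two internal vertices adjacent to `s` and at least two internal
vertices adjacent to `t`. -/
theorem stmt7 [Fintype V] (G : SimpleGraph V)
    (hBi : Biconnected G) (hSP : ¬ ContainsK4Subdivision G)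
    (hTr : NoTransitiveEdges G)
    (s t : V) (hst : SepPair G s t)
    (C : Set V) (hC : IsCompAt G s t C) (hL : Light G s t C)
    (h2 : 2 ≤ C.ncard) :
    ¬ (2 ≤ ({v ∈ C | G.Adj v s}).ncard ∧ 2 ≤ ({v ∈ C | G.Adj v t}).ncard) := by
  rintro ⟨hs2, ht2⟩
  obtain ⟨hCne, hCD, hCc, hCcl⟩ := hC
  obtain ⟨hne, hsep⟩ := hst
  have hcC := connSet_of_induce hCc.preconnected
  have hs : ∀ p, ∃ q ∈ C, G.Adj q s ∧ q ≠ p := by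
    intro p
    obtain ⟨q, hq, hqp⟩ := Set.exists_ne_of_one_lt_ncard (Nat.lt_of_succ_le hs2) p
    exact ⟨q, hq.1, hq.2, hqp⟩
  have ht : ∀ p, ∃ q ∈ C, G.Adj q t ∧ q ≠ p := by
    intro p
    obtain ⟨q, hq, hqp⟩ := Set.exists_ne_of_one_lt_ncard (Nat.lt_of_succ_le ht2) p
    exact ⟨q, hq.1, hq.2, hqp⟩
  -- another component
  obtain ⟨d, hdX, hdC⟩ : ∃ d ∈ {v | v ≠ s ∧ v ≠ t}, d ∉ C := by
    by_contra hcon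
    push Not at hcon
    have : C = {v | v ≠ s ∧ v ≠ t} := Set.Subset.antisymm hCD hcon
    rw [← this] at hsep
    exact hsep hCc.preconnected
  obtain ⟨D, hdD, hDX, hDc, hDcl⟩ := exists_comp G ({v | v ≠ s ∧ v ≠ t} \ C) d ⟨hdX, hdC⟩
  have hDcl' : ∀ u ∈ D, ∀ w, w ≠ s → w ≠ t → G.Adj u w → w ∈ D := by
    intro u hu w hws hwt huw
    refine hDcl u hu w ⟨⟨hws, hwt⟩, fun hwC => ?_⟩ huw
    exact (hDX hu).2 (hCcl w hwC u (hDX hu).1 huw.symm)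
  have hDs : ∃ a ∈ D, G.Adj a s := by
    obtain ⟨a, ha, b, hb, hbD, hab⟩ := exists_leaving
      (connSet_of_induce (hBi.2.2 t).preconnected) hdD hdX.2 (fun h : s ∈ D => (hDX h).1.1 rfl) hne
    have : b = s := by
      by_contra hbs
      exact hbD (hDcl' a ha b hbs hb hab)
    exact ⟨a, ha, this ▸ hab⟩
  have hDt : ∃ a ∈ D, G.Adj a t := by
    obtain ⟨a, ha, b, hb, hbD, hab⟩ := exists_leaving
      (connSet_of_induce (hBi.2.2 s).preconnected) hdD hdX.1 (fun h : t ∈ D => (hDX h).1.2 rfl)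
      hne.symm
    have : b = t := by
      by_contra hbt
      exact hbD (hDcl' a ha b hb hbt hab)
    exact ⟨a, ha, this ▸ hab⟩
  obtain ⟨ds, hds, eds⟩ := hDs
  obtain ⟨dt, hdt, edt⟩ := hDt
  have hSc : ConnSet G ({s} ∪ D) := connSet_union (connSet_singleton G s) hDc rfl hds eds.symm
  have hSTc : ConnSet G (({s} ∪ D) ∪ {t}) :=
    connSet_union hSc (connSet_singleton G t) (Or.inr hdt) rfl edt
  have hCS : ∀ v ∈ C, v ∉ ({s} ∪ D : Set V) := by
    rintro v hv (h | h)
    · exact (hCD hv).1 h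
    · exact (hDX h).2 hv
  have hCt : ∀ v ∈ C, v ∉ ({t} : Set V) := fun v hv h => (hCD hv).2 h
  have hK : ∀ A B : Set V, A ⊆ C → B ⊆ C → (∀ v ∈ A, v ∉ B) → ConnSet G A → ConnSet G B →
      Touch G A B → (∃ v ∈ A, G.Adj v s) → (∃ v ∈ A, G.Adj v t) → (∃ v ∈ B, G.Adj v s) →
      (∃ v ∈ B, G.Adj v t) → False := by
    rintro A B hA hB hAB cA cB tAB ⟨as, has, eas⟩ ⟨aa, haa, eaa⟩ ⟨bs, hbs, ebs⟩ ⟨bt, hbt, ebt⟩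
    refine hSP (k4_of_model cA cB hSc (connSet_singleton G t) hAB
      (fun v hv => hCS v (hA hv)) (fun v hv => hCt v (hA hv)) (fun v hv => hCS v (hB hv))
      (fun v hv => hCt v (hB hv)) ?_ tAB ⟨as, has, s, Or.inl rfl, eas⟩ ⟨aa, haa, t, rfl, eaa⟩
      ⟨bs, hbs, s, Or.inl rfl, ebs⟩ ⟨bt, hbt, t, rfl, ebt⟩ ⟨dt, Or.inr hdt, t, rfl, edt⟩)
    rintro v (hv | hv) h
    · exact hne ((show v = s from hv).symm.trans h)
    · exact (hDX hv).1.2 h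
  have touchST : ∀ A : Set V, A ⊆ C → ∀ a ∈ A, Touch G A (({s} ∪ D) ∪ {t}) := by
    intro A hA a ha
    rcases hL a (hA ha) with h | h
    · exact ⟨a, ha, s, by simp, h⟩
    · exact ⟨a, ha, t, by simp, h⟩
  have dST : ∀ v ∈ C, v ∉ (({s} ∪ D) ∪ {t} : Set V) := by
    rintro v hv (h | h)
    · exact hCS v hv h
    · exact hCt v hv h
  have hleaf : ∀ l ∈ C, ConnSet G (C \ {l}) → ∃ p ∈ C, G.Adj l p ∧
      (∀ q ∈ C, G.Adj l q → q = p) ∧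
      ((G.Adj l s ∧ ¬ G.Adj l t ∧ G.Adj p t ∧ ¬ G.Adj p s) ∨
       (G.Adj l t ∧ ¬ G.Adj l s ∧ G.Adj p s ∧ ¬ G.Adj p t)) := by
    intro l hl hcl
    obtain ⟨qs, hqs, eqs, nqs⟩ := hs l
    obtain ⟨qt, hqt, eqt, nqt⟩ := ht l
    obtain ⟨a, ha, p, hp, hpl, hlp⟩ := exists_leaving (D := {l}) (u := l) hcC rfl hl nqs hqs
    obtain rfl : a = l := ha
    have hpl : p ≠ a := hpl
    have huniq : ∀ q ∈ C, G.Adj a q → q = p := by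
      intro q hq haq
      by_contra hqp
      obtain ⟨Q, hqQ, hQX, hQc, hQcl⟩ := exists_comp G ((C \ {a}) \ {p}) q
        ⟨⟨hq, haq.ne'⟩, hqp⟩
      obtain ⟨x, hx, y, hy, hyQ, hxy⟩ := exists_leaving hcl hqQ ⟨hq, haq.ne'⟩
        (fun h : p ∈ Q => (hQX h).2 rfl) ⟨hp, hpl⟩
      have hyp : y = p := by
        by_contra hyp
        exact hyQ (hQcl x hx y ⟨hy, hyp⟩ hxy)
      subst hyp
      have hQC : Q ⊆ C := fun v hv => (hQX hv).1.1
      have haC : ({a} : Set V) ⊆ C := by rintro v rfl; exact hl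
      have hpC : ({y} : Set V) ⊆ C := by rintro v rfl; exact hp
      refine hSP (k4_of_model (connSet_singleton G a) (connSet_singleton G y) hQc hSTc
        ?_ ?_ (fun v hv => dST v (haC hv)) ?_ (fun v hv => dST v (hpC hv))
        (fun v hv => dST v (hQC hv)) ⟨a, rfl, y, rfl, hlp⟩ ⟨a, rfl, q, hqQ, haq⟩
        (touchST _ haC a rfl) ⟨y, rfl, x, hx, hxy.symm⟩ (touchST _ hpC y rfl)
        (touchST _ hQC q hqQ))
      · rintro v rfl h
        exact hpl h.symm
      · rintro v rfl h
        exact (hQX h).1.2 rfl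
      · rintro v rfl h
        exact (hQX h).2 rfl
    refine ⟨p, hp, hlp, huniq, ?_⟩
    have hnb : ¬ (G.Adj a s ∧ G.Adj a t) := by
      rintro ⟨h1, h2⟩
      refine hK {a} (C \ {a}) ?_ Set.sdiff_subset (fun v hv h => h.2 hv) (connSet_singleton G a) hcl
        ⟨a, rfl, p, ⟨hp, hpl⟩, hlp⟩ ⟨a, rfl, h1⟩ ⟨a, rfl, h2⟩ ⟨qs, ⟨hqs, nqs⟩, eqs⟩
        ⟨qt, ⟨hqt, nqt⟩, eqt⟩
      rintro v rfl
      exact hl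
    rcases hL a hl with h | h
    · have hat : ¬ G.Adj a t := fun h' => hnb ⟨h, h'⟩
      have hps := no_trans hTr hne hCD hCcl hl hp hlp huniq hat
      exact Or.inl ⟨h, hat, (hL p hp).resolve_left hps, hps⟩
    · have has : ¬ G.Adj a s := fun h' => hnb ⟨h', h⟩
      have hps := no_trans hTr (s := t) (t := s) hne.symm (fun v hv => (hCD hv).symm)
        (fun u hu w hw => hCcl u hu w hw.symm) hl hp hlp huniq has
      exact Or.inr ⟨h, has, (hL p hp).resolve_right hps, hps⟩
  -- find a first leaf
  obtain ⟨x, hx⟩ := hCne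
  obtain ⟨f, hf0, hf1, hf2⟩ := exists_dist G C hCc x hx
  obtain ⟨l, hl, hmax⟩ := Set.exists_max_image C f (Set.toFinite C) ⟨x, hx⟩
  have hlx : l ≠ x := by
    rintro rfl
    obtain ⟨q, hq, _, hql⟩ := hs l
    obtain ⟨u, _, _, hu⟩ := hf1 q hq hql
    have := hmax q hq
    omega
  obtain ⟨p, hp, hlp, huniq, h⟩ := hleaf l hl (far_noncut hx hlx hf1 hmax)
  rcases h with ⟨h1, h2, h3, h4⟩ | ⟨h1, h2, h3, h4⟩
  · exact finish hCc hK hleaf ht hl hp hlp huniq h1 h2 h3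
  · refine finish (s := t) (t := s) hCc ?_ ?_ hs hl hp hlp huniq h1 h2 h3
    · intro A B hA hB hAB cA cB tAB a1 a2 b1 b2
      exact hK A B hA hB hAB cA cB tAB a2 a1 b2 b1
    · intro l hl hcl
      obtain ⟨p, hp, hlp, hu, h⟩ := hleaf l hl hcl
      exact ⟨p, hp, hlp, hu, h.symm⟩
end

section
/- Let G be a biconnected series-parallel simple graph with no transitive edges, let (s,t) be a separation pair of G, and let G' be a component of G with respect to (s,t). Then G' is heavy if and only if there is a path from s to t all of whose vertices belong to G' whose length (number of edges) is at least 4. -/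
open SimpleGraph

variable {V : Type*}

theorem aux_split {G : SimpleGraph V} {u v x : V} (p : G.Walk u v) (hp : p.IsPath)
    (hx : x ∈ p.support) :
    ∃ (q : G.Walk u x) (r : G.Walk x v), q.IsPath ∧ r.IsPath ∧
      (∀ y, y ∈ p.support ↔ y ∈ q.support ∨ y ∈ r.support) ∧
      (∀ y, y ∈ q.support → y ∈ r.support → y = x) ∧ p.length = q.length + r.length := by
  obtain ⟨q, r, hq, hr, rfl⟩ := hp.mem_support_iff_exists_append.1 hx
  refine ⟨q, r, hq, hr, fun y => Walk.mem_support_append_iff _ _, ?_, Walk.length_append _ _⟩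
  intro y h1 h2
  by_contra h
  exact hp.ne_of_mem_support_of_append h h1 h2 rfl

theorem aux_append {G : SimpleGraph V} {u v w : V} (p : G.Walk u v) (q : G.Walk v w)
    (hp : p.IsPath) (hq : q.IsPath) (h : ∀ y, y ∈ p.support → y ∈ q.support → y = v) :
    (p.append q).IsPath := by
  induction p with
  | nil => simpa using hq
  | cons hadj p ih =>
    rw [Walk.cons_append, Walk.cons_isPath_iff]
    rw [Walk.cons_isPath_iff] at hp
    refine ⟨ih q hp.1 hq (fun y h1 h2 => h y (by simp [h1]) h2), ?_⟩
    rw [Walk.mem_support_append_iff]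
    rintro (h1 | h1)
    · exact hp.2 h1
    · have := h _ (by simp) h1
      subst this
      exact hp.2 (by simp)

theorem aux_toPath {G : SimpleGraph V} {u v : V} (p : G.Walk u v) :
    ∃ q : G.Walk u v, q.IsPath ∧ ∀ y ∈ q.support, y ∈ p.support := by
  classical
  exact ⟨p.bypass, p.bypass_isPath, fun y hy => p.support_bypass_subset_support hy⟩

theorem aux_firstHit {G : SimpleGraph V} (S : Set V) {u v : V} (p : G.Walk u v) (hv : v ∈ S) :
    ∃ z ∈ S, ∃ q : G.Walk u z, q.IsPath ∧ (∀ y ∈ q.support, y ∈ p.support) ∧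
      ∀ y ∈ q.support, y ∈ S → y = z := by
  suffices h : ∃ z ∈ S, ∃ q : G.Walk u z, (∀ y ∈ q.support, y ∈ p.support) ∧
      ∀ y ∈ q.support, y ∈ S → y = z by
    obtain ⟨z, hz, q, h1, h2⟩ := h
    obtain ⟨r, hr, h3⟩ := aux_toPath q
    exact ⟨z, hz, r, hr, fun y hy => h1 y (h3 y hy), fun y hy => h2 y (h3 y hy)⟩
  induction p with
  | nil => exact ⟨_, hv, Walk.nil, by simp, by simp⟩
  | @cons a b c hadj p ih =>
    by_cases ha : a ∈ S
    · exact ⟨a, ha, Walk.nil, by simp, by simp⟩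
    · obtain ⟨z, hz, q, h1, h2⟩ := ih hv
      refine ⟨z, hz, Walk.cons hadj q, ?_, ?_⟩
      · intro y hy
        rw [Walk.support_cons, List.mem_cons] at hy ⊢
        exact hy.imp id (h1 y)
      · intro y hy hyS
        rw [Walk.support_cons, List.mem_cons] at hy
        rcases hy with rfl | hy
        · exact absurd hyS ha
        · exact h2 y hy hyS

theorem aux_induceWalk {G : SimpleGraph V} (S : Set V) (h : (G.induce S).Preconnected)
    {u v : V} (hu : u ∈ S) (hv : v ∈ S) :
    ∃ p : G.Walk u v, ∀ y ∈ p.support, y ∈ S := by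
  obtain ⟨p⟩ := h ⟨u, hu⟩ ⟨v, hv⟩
  refine ⟨p.map (Embedding.induce S).toHom, ?_⟩
  intro y hy
  have hy' := (Walk.support_map (Embedding.induce S).toHom p) ▸ hy
  obtain ⟨z, -, rfl⟩ := List.mem_map.1 hy'
  exact z.2

/-- reroute a path through a vertex adjacent to it, the ear returning after `u` -/
theorem aux_ear {G : SimpleGraph V} {s t u w z : V} (q : G.Walk s u) (r : G.Walk u t)
    (hq : q.IsPath) (hr : r.IsPath) (hqr : ∀ y, y ∈ q.support → y ∈ r.support → y = u)
    (hadj : G.Adj u w) (R : G.Walk w z) (hR : R.IsPath) (hu : u ∉ R.support)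
    (hz : z ∈ r.support)
    (hRP : ∀ y ∈ R.support, (y ∈ q.support ∨ y ∈ r.support) → y = z) :
    ∃ p : G.Walk s t, p.IsPath ∧ w ∈ p.support := by
  obtain ⟨r1, r2, hr1, hr2, hrm, hrd, -⟩ := aux_split r hr hz
  have hzu : z ≠ u := by rintro rfl; exact hu (by simp)
  have hur2 : u ∉ r2.support := fun h => hzu (hrd u (by simp) h).symm
  have h1 : (R.append r2).IsPath :=
    aux_append _ _ hR hr2 fun y h1 h2 => hRP y h1 (Or.inr ((hrm y).2 (Or.inr h2)))
  have h2 : (Walk.cons hadj (R.append r2)).IsPath := by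
    rw [Walk.cons_isPath_iff, Walk.mem_support_append_iff]
    exact ⟨h1, by tauto⟩
  refine ⟨q.append (Walk.cons hadj (R.append r2)), aux_append _ _ hq h2 ?_, ?_⟩
  · intro y hy hy2
    rw [Walk.support_cons, List.mem_cons, Walk.mem_support_append_iff] at hy2
    rcases hy2 with h | h | h
    · exact h
    · have := hRP y h (Or.inl hy)
      subst this
      exact hqr _ hy hz
    · exact hqr _ hy ((hrm y).2 (Or.inr h))
  · simp [Walk.mem_support_append_iff]

theorem aux_through [Fintype V] (G : SimpleGraph V) (hBi : Biconnected G) (s t : V)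
    (hst : s ≠ t) (v : V) : ∃ p : G.Walk s t, p.IsPath ∧ v ∈ p.support := by
  obtain ⟨-, hcon, hdel⟩ := hBi
  obtain ⟨p0⟩ := hcon.preconnected s t
  obtain ⟨p0, hp0, -⟩ := aux_toPath p0
  obtain ⟨W⟩ := hcon.preconnected s v
  have key : ∀ {a b : V} (W : G.Walk a b), (∃ p : G.Walk s t, p.IsPath ∧ a ∈ p.support) →
      ∃ p : G.Walk s t, p.IsPath ∧ b ∈ p.support := by
    intro a b W
    induction W with
    | nil => exact id
    | @cons u w b hadj W ih =>
      rintro ⟨p, hp, hup⟩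
      apply ih
      by_cases hw : w ∈ p.support
      · exact ⟨p, hp, hw⟩
      obtain ⟨e, hep, heu⟩ : ∃ e ∈ p.support, e ≠ u := by
        by_cases h : s = u
        · exact ⟨t, by simp, fun h' => hst (h.trans h'.symm)⟩
        · exact ⟨s, by simp, h⟩
      obtain ⟨R0, hR0⟩ := aux_induceWalk {v | v ≠ u} (hdel u).preconnected
        (u := w) (v := e) hadj.ne' heu
      obtain ⟨z, hz, R, hR, hRs, hRP⟩ := aux_firstHit {y | y ∈ p.support} R0 hep
      have huR : u ∉ R.support := fun h => hR0 u (hRs u h) rfl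
      obtain ⟨q, r, hq, hr, hm, hd, -⟩ := aux_split p hp hup
      rcases (hm z).1 hz with hzq | hzr
      · obtain ⟨p', hp', hw'⟩ := aux_ear r.reverse q.reverse hr.reverse hq.reverse
          (fun y h1 h2 => hd y (by simpa using h2) (by simpa using h1)) hadj R hR huR
          (by simpa using hzq)
          (fun y hy h => hRP y hy ((hm y).2 (by simpa [or_comm] using h)))
        exact ⟨p'.reverse, hp'.reverse, by simpa using hw'⟩
      · exact aux_ear q r hq hr hd hadj R hR huR hzr
          (fun y hy h => hRP y hy ((hm y).2 h))
  exact key W ⟨p0, hp0, by simp⟩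

theorem aux_closed {G : SimpleGraph V} (s t : V) (D : Set V)
    (hD : ∀ u ∈ D, ∀ w, w ≠ s → w ≠ t → G.Adj u w → w ∈ D) {y z : V} (p : G.Walk y z)
    (hp : p.IsPath) (hz : z = s) (hy : y ∈ D) (ht : t ∉ p.support) :
    ∀ x ∈ p.support, x = s ∨ x ∈ D := by
  induction p with
  | nil => intro x hx; simp at hx; subst hx; exact Or.inr hy
  | @cons a b c hadj p ih =>
    rw [Walk.cons_isPath_iff] at hp
    rw [Walk.support_cons, List.mem_cons, not_or] at ht
    intro x hx
    rw [Walk.support_cons, List.mem_cons] at hx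
    rcases hx with rfl | hx
    · exact Or.inr hy
    by_cases hb : b = s
    · subst hb; subst hz
      obtain rfl := Walk.nil_iff_eq_nil.1 (Walk.isPath_iff_nil.1 hp.1)
      simp at hx
      exact Or.inl hx
    · refine ih hp.1 hz (hD a hy b hb ?_ hadj) ht.2 x hx
      rintro rfl
      exact ht.2 (by simp)

theorem aux_K4 {G : SimpleGraph V} (hSP : ¬ ContainsK4Subdivision G) {s x a b : V}
    (hadj : G.Adj s x) (p q : G.Walk s x) (hp : p.IsPath) (hq : q.IsPath)
    (hpq : ∀ y, y ∈ p.support → y ∈ q.support → y = s ∨ y = x)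
    (ha : a ∈ p.support) (has : a ≠ s) (hax : a ≠ x)
    (hb : b ∈ q.support) (hbs : b ≠ s) (hbx : b ≠ x)
    (R : G.Walk a b) (hR : R.IsPath) (hsR : s ∉ R.support) (hxR : x ∉ R.support)
    (hRp : ∀ y ∈ R.support, y ∈ p.support → y = a)
    (hRq : ∀ y ∈ R.support, y ∈ q.support → y = b) : False := by
  obtain ⟨p1, p2, hp1, hp2, hpm, hpd, -⟩ := aux_split p hp ha
  obtain ⟨q1, q2, hq1, hq2, hqm, hqd, -⟩ := aux_split q hq hb
  have hab : a ≠ b := by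
    rintro rfl
    rcases hpq a ha hb with h | h
    · exact has h
    · exact hax h
  have hsp2 : s ∉ p2.support := fun h => has (hpd s (by simp) h).symm
  have hxp1 : x ∉ p1.support := fun h => hax (hpd x h (by simp)).symm
  have hsq2 : s ∉ q2.support := fun h => hbs (hqd s (by simp) h).symm
  have hxq1 : x ∉ q1.support := fun h => hbx (hqd x h (by simp)).symm
  have hp1s : ∀ y, y ∈ p1.support → y ∈ p.support := fun y h => (hpm y).2 (Or.inl h)
  have hp2s : ∀ y, y ∈ p2.support → y ∈ p.support := fun y h => (hpm y).2 (Or.inr h)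
  have hq1s : ∀ y, y ∈ q1.support → y ∈ q.support := fun y h => (hqm y).2 (Or.inl h)
  have hq2s : ∀ y, y ∈ q2.support → y ∈ q.support := fun y h => (hqm y).2 (Or.inr h)
  have hanq : a ∉ q.support := fun h => (hpq a ha h).elim has hax
  have hbnp : b ∉ p.support := fun h => (hpq b h hb).elim hbs hbx
  have hsx : s ≠ x := hadj.ne
  apply hSP
  refine ⟨s, x, a, b, Walk.cons hadj Walk.nil, p1, q1, p2.reverse, q2.reverse, R, ?_, ?_, hp1,
    hq1, hp2.reverse, hq2.reverse, hR, ?_, ?_⟩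
  · simp; tauto
  · simp [hsx]
  · simp only [List.pairwise_cons, List.mem_cons, List.not_mem_nil, or_false, Set.disjoint_left,
      forall_eq_or_imp, forall_eq, interiorSet, Set.mem_ofPred_eq, Walk.support_reverse,
      List.mem_reverse, Walk.support_cons, Walk.support_nil]
    repeat' refine And.intro ?_ ?_
    all_goals first | exact List.Pairwise.nil | grind
  · simp only [List.mem_cons, List.not_mem_nil, or_false,
      forall_eq_or_imp, forall_eq, interiorSet, Set.mem_ofPred_eq, Walk.support_reverse,
      List.mem_reverse, Walk.support_cons, Walk.support_nil, Set.mem_insert_iff,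
      Set.mem_singleton_iff]
    repeat' refine And.intro ?_ ?_
    all_goals grind

theorem aux_chord {G : SimpleGraph V} (hSP : ¬ ContainsK4Subdivision G) {s x a b : V}
    (hadj : G.Adj s x) (p q : G.Walk s x) (hp : p.IsPath) (hq : q.IsPath)
    (hpq : ∀ y, y ∈ p.support → y ∈ q.support → y = s ∨ y = x)
    (ha : a ∈ p.support) (has : a ≠ s) (hax : a ≠ x)
    (hb : b ∈ q.support) (hbs : b ≠ s) (hbx : b ≠ x) : SepPair G s x := by
  refine ⟨hadj.ne, fun hcon => ?_⟩
  obtain ⟨R0, hR0⟩ := aux_induceWalk {v | v ≠ s ∧ v ≠ x} hcon (u := a) (v := b)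
    ⟨has, hax⟩ ⟨hbs, hbx⟩
  -- last vertex on `p`, via the reverse of a path to the first vertex on `q`
  obtain ⟨b', hb', R1, hR1, hR1s, hR1q⟩ := aux_firstHit {y | y ∈ q.support} R0 hb
  obtain ⟨a', ha', R2, hR2, hR2s, hR2p⟩ := aux_firstHit {y | y ∈ p.support} R1.reverse ha
  have hR2s' : ∀ y ∈ R2.support, y ∈ R1.support := fun y hy => by simpa using hR2s y hy
  have hav : ∀ y ∈ R2.support, y ≠ s ∧ y ≠ x := fun y hy => hR0 y (hR1s y (hR2s' y hy))
  have h1 := hav a' (by simp)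
  have h2 := hav b' (by simp)
  refine aux_K4 hSP hadj p q hp hq hpq ha' h1.1 h1.2 hb' h2.1 h2.2 R2.reverse hR2.reverse
    ?_ ?_ ?_ ?_
  · intro h; exact (hav s (by simpa using h)).1 rfl
  · intro h; exact (hav x (by simpa using h)).2 rfl
  · intro y hy; exact hR2p y (by simpa using hy)
  · intro y hy; exact hR1q y (hR2s' y (by simpa using hy))

theorem aux_outside [Fintype V] (G : SimpleGraph V) (hBi : Biconnected G) (s t : V)
    (hst : SepPair G s t) (C : Set V) (hC : IsCompAt G s t C) :
    ∃ p : G.Walk s t, p.IsPath ∧ ∀ y ∈ p.support, y ∉ C := by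
  obtain ⟨-, hsub, hCc, hcl⟩ := hC
  obtain ⟨hne, hnp⟩ := hst
  have hsC : s ∉ C := fun h => (hsub h).1 rfl
  have htC : t ∉ C := fun h => (hsub h).2 rfl
  obtain ⟨y, hys, hyt, hyC⟩ : ∃ y, y ≠ s ∧ y ≠ t ∧ y ∉ C := by
    by_contra! h
    have : {v | v ≠ s ∧ v ≠ t} = C := Set.Subset.antisymm (fun v hv => h v hv.1 hv.2) hsub
    exact hnp (this ▸ hCc.preconnected)
  let D : Set V := {v | v ≠ s ∧ v ≠ t ∧ v ∉ C}
  have hD : ∀ u ∈ D, ∀ w, w ≠ s → w ≠ t → G.Adj u w → w ∈ D := fun u hu w h1 h2 hadj =>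
    ⟨h1, h2, fun hw => hu.2.2 (hcl w hw u ⟨hu.1, hu.2.1⟩ hadj.symm)⟩
  have hyD : y ∈ D := ⟨hys, hyt, hyC⟩
  obtain ⟨A0, hA0⟩ := aux_induceWalk {v | v ≠ t} (hBi.2.2 t).preconnected (u := y) (v := s) hyt hne
  obtain ⟨B0, hB0⟩ := aux_induceWalk {v | v ≠ s} (hBi.2.2 s).preconnected (u := y) (v := t)
    hys hne.symm
  obtain ⟨A, hA, hAs⟩ := aux_toPath A0
  obtain ⟨B, hB, hBs⟩ := aux_toPath B0
  have hA' := aux_closed s t D hD A hA rfl hyD (fun h => hA0 t (hAs t h) rfl)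
  have hB' := aux_closed t s D (fun u hu w h1 h2 => hD u hu w h2 h1) B hB rfl hyD
    (fun h => hB0 s (hBs s h) rfl)
  obtain ⟨P, hP, hPs⟩ := aux_toPath (A.reverse.append B)
  refine ⟨P, hP, fun z hz => ?_⟩
  have := hPs z hz
  rw [Walk.mem_support_append_iff, Walk.support_reverse, List.mem_reverse] at this
  rcases this with h | h
  · rcases hA' z h with rfl | h
    · exact hsC
    · exact h.2.2
  · rcases hB' z h with rfl | h
    · exact htC
    · exact h.2.2

theorem aux_len {G : SimpleGraph V} {u v : V} (p : G.Walk u v) (hne : u ≠ v)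
    (hna : ¬ G.Adj u v) : 2 ≤ p.length := by
  by_contra! h
  have h0 : p.length ≠ 0 := fun h => hne (Walk.eq_of_length_eq_zero h)
  exact hna (Walk.adj_of_length_eq_one (p := p) (by omega))

/-- In a biconnected series-parallel simple graph without transitive edges, a component
w.r.t. a separation pair `(s, t)` is heavy if and only if it contains a path from `s` to
`t` of length at least four. -/
theorem stmt9 [Fintype V] (G : SimpleGraph V)
    (hBi : Biconnected G) (hSP : ¬ ContainsK4Subdivision G)
    (hTr : NoTransitiveEdges G)
    (s t : V) (hst : SepPair G s t)
    (C : Set V) (hC : IsCompAt G s t C) :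
    Heavy G s t C ↔
      ∃ (w : G.Walk s t), w.IsPath ∧
        (∀ x ∈ w.support, x = s ∨ x = t ∨ x ∈ C) ∧ 4 ≤ w.length := by
  have hsub := hC.2.1
  have hcl := hC.2.2.2
  have hne := hst.1
  have hsC : s ∉ C := fun h => (hsub h).1 rfl
  have htC : t ∉ C := fun h => (hsub h).2 rfl
  constructor
  · rintro ⟨v, hv, hvs, hvt⟩
    have hv1 : v ≠ s := (hsub hv).1
    have hv2 : v ≠ t := (hsub hv).2
    obtain ⟨p, hp, hvp⟩ := aux_through G hBi s t hne v
    obtain ⟨q, r, hq, hr, hm, hd, hlen⟩ := aux_split p hp hvp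
    have hcl' : ∀ u ∈ C, ∀ w, w ≠ s → w ≠ t → G.Adj u w → w ∈ C :=
      fun u hu w h1 h2 => hcl u hu w ⟨h1, h2⟩
    refine ⟨p, hp, fun x hx => ?_, ?_⟩
    · rcases (hm x).1 hx with h | h
      · have := aux_closed s t C hcl' q.reverse hq.reverse rfl hv
          (fun h => hv2 (hd t (by simpa using h) (by simp)).symm) x (by simpa using h)
        tauto
      · have := aux_closed t s C (fun u hu w h1 h2 => hcl' u hu w h2 h1) r hr rfl hv
          (fun h => hv1 (hd s (by simp) h).symm) x h
        tauto
    · have h1 := aux_len q hv1.symm (fun h => hvs h.symm)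
      have h2 := aux_len r hv2 hvt
      omega
  · rintro ⟨w, hw, hws, hlen⟩
    by_contra hheavy
    have hlight : ∀ v ∈ C, G.Adj v s ∨ G.Adj v t := by
      intro v hv
      by_contra h
      rw [not_or] at h
      exact hheavy ⟨v, hv, h⟩
    obtain ⟨O, hO, hOC⟩ := aux_outside G hBi s t hst C hC
    match w, hw, hws, hlen with
    | .cons (v := x1) h1 (.cons (v := x2) h2 (.cons (v := x3) h3 p)), hw, hws, hlen =>
      simp only [Walk.cons_isPath_iff, Walk.support_cons, List.mem_cons, not_or] at hw
      obtain ⟨⟨⟨hp, hx2p⟩, hx12, hx1p⟩, hs1, hs2, hsp⟩ := hw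
      simp only [Walk.support_cons, List.mem_cons] at hws
      have ht1 : x1 ≠ t := by rintro rfl; exact hx1p (by simp)
      have ht2 : x2 ≠ t := by rintro rfl; exact hx2p (by simp)
      have ht3 : x3 ≠ t := by
        rintro rfl
        obtain rfl := Walk.nil_iff_eq_nil.1 (Walk.isPath_iff_nil.1 hp)
        simp at hlen
      have hx23 : x2 ≠ x3 := h3.ne
      have hx1C : x1 ∈ C := by
        rcases hws x1 (by simp) with h | h | h
        · exact absurd h.symm hs1
        · exact absurd h ht1
        · exact h
      have hx2C : x2 ∈ C := by
        rcases hws x2 (by simp) with h | h | h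
        · exact absurd h.symm hs2
        · exact absurd h ht2
        · exact h
      have hpC : ∀ y ∈ p.support, y = t ∨ y ∈ C := by
        intro y hy
        rcases hws y (by simp [hy]) with h | h | h
        · subst h; exact absurd hy hsp
        · exact Or.inl h
        · exact Or.inr h
      let P1 : G.Walk s x2 := .cons h1 (.cons h2 .nil)
      let P2 : G.Walk x2 t := .cons h3 p
      have hP1 : P1.IsPath := by simp [P1, hs1, hs2, hx12]
      have hP2 : P2.IsPath := by simp [P2, hp, hx2p]
      have m1 : ∀ y, y ∈ P1.support ↔ y = s ∨ y = x1 ∨ y = x2 := by simp [P1]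
      have m2 : ∀ y, y ∈ P2.support ↔ y = x2 ∨ y ∈ p.support := by simp [P2]
      rcases hlight x2 hx2C with hadj | hadj
      · have hQ : (O.append P2.reverse).IsPath := by
          refine aux_append _ _ hO hP2.reverse ?_
          intro y hy hy2
          rw [Walk.support_reverse, List.mem_reverse, m2] at hy2
          have := hOC y hy
          grind
        refine hTr s x2 (aux_chord hSP hadj.symm P1 (O.append P2.reverse) hP1 hQ ?_
          (a := x1) (b := t) (by simp [m1]) (Ne.symm hs1) hx12
          (by simp [Walk.mem_support_append_iff]) hne.symm ht2.symm) hadj.symm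
        intro y hy hy2
        rw [Walk.mem_support_append_iff, Walk.support_reverse, List.mem_reverse, m2] at hy2
        rw [m1] at hy
        have := hOC y
        grind
      · have hQ : (O.reverse.append P1).IsPath := by
          refine aux_append _ _ hO.reverse hP1 ?_
          intro y hy hy2
          rw [Walk.support_reverse, List.mem_reverse] at hy
          rw [m1] at hy2
          have := hOC y hy
          grind
        refine hTr t x2 (aux_chord hSP hadj.symm P2.reverse (O.reverse.append P1) hP2.reverse hQ ?_
          (a := x3) (b := s) (by simp [m2]) ht3 hx23.symm
          (by simp [Walk.mem_support_append_iff]) hne hs2) hadj.symm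
        intro y hy hy2
        rw [Walk.mem_support_append_iff, Walk.support_reverse, List.mem_reverse, m1] at hy2
        rw [Walk.support_reverse, List.mem_reverse, m2] at hy
        have := hOC y
        grind
end
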